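/- arXiv:1808.00483 — 5 statements merged into one kernel-verified Lean document; each statement's English description precedes it below -/
import Mathlib

section
/- Let d be a metric on X with respect to which the action T is 1-Lipschitz, and let x ∈ X be a transitive point. If S, S' : X → X are d-continuous maps satisfying S ∘ T_g = T_g ∘ S and S' ∘ T_g = T_g ∘ S' for all g ∈ G, then sup_{y ∈ X} d(S y, S' y) = d(S x, S' x); that is, the evaluation map at x is an isometry on the commutant Λ = {S ∈ C_d(X) : S T_g = T_g S for all g ∈ G} equipped with the uniform metric. -/
/-- Let `d` be a metric (bounded by 1) on `X` with respect to which the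
action `T` is 1-Lipschitz, and let `x ∈ X` be a transitive point. If `S, S' : X → X` are
`d`-continuous maps commuting with every `T g`, then
`⨆ y, d (S y) (S' y) = d (S x) (S' x)`; i.e. the evaluation map at `x` is an isometry
on the commutant `Λ` equipped with the uniform metric. -/
theorem evaluation_isometry
    {G : Type*} [AddCommMonoid G] [Countable G]
    (hcancel : ∀ g h k : G, g + h = g + k → h = k)
    (hnoinv : ∀ g h : G, g + h = 0 → g = 0 ∧ h = 0)
    {X : Type*}
    (T : G → X → X)
    (hT0 : T 0 = id)
    (hTadd : ∀ g h : G, T (g + h) = T g ∘ T h)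
    -- `d` is a metric on `X`, bounded by 1
    (d : X → X → ℝ)
    (hd_eq : ∀ x y : X, d x y = 0 ↔ x = y)
    (hd_symm : ∀ x y : X, d x y = d y x)
    (hd_tri : ∀ x y z : X, d x z ≤ d x y + d y z)
    (hd_nonneg : ∀ x y : X, 0 ≤ d x y)
    (hd_bdd : ∀ x y : X, d x y ≤ 1)
    -- `T` is 1-Lipschitz with respect to `d`
    (hlip : ∀ (g : G) (x y : X), d (T g x) (T g y) ≤ d x y)
    -- `x` is a transitive point: the orbit of `x` is `d`-dense
    (x : X)
    (hx : ∀ (y : X) (ε : ℝ), 0 < ε → ∃ g : G, d (T g x) y < ε)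
    -- `S`, `S'` are `d`-continuous and commute with the action
    (S S' : X → X)
    (hScont : ∀ (z : X) (ε : ℝ), 0 < ε → ∃ δ : ℝ, 0 < δ ∧
      ∀ w : X, d z w < δ → d (S z) (S w) < ε)
    (hS'cont : ∀ (z : X) (ε : ℝ), 0 < ε → ∃ δ : ℝ, 0 < δ ∧
      ∀ w : X, d z w < δ → d (S' z) (S' w) < ε)
    (hScomm : ∀ g : G, S ∘ T g = T g ∘ S)
    (hS'comm : ∀ g : G, S' ∘ T g = T g ∘ S') :
    (⨆ y : X, d (S y) (S' y)) = d (S x) (S' x) := by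
  have key : ∀ y, d (S y) (S' y) ≤ d (S x) (S' x) := by
    intro y
    refine le_of_forall_pos_lt_add fun ε hε => ?_
    obtain ⟨δ, hδ, hS⟩ := hScont y (ε / 2) (half_pos hε)
    obtain ⟨δ', hδ', hS'⟩ := hS'cont y (ε / 2) (half_pos hε)
    obtain ⟨g, hg⟩ := hx y (min δ δ') (lt_min hδ hδ')
    rw [hd_symm] at hg
    have h₁ := hS _ (hg.trans_le (min_le_left _ _))
    have h₂ := hS' _ (hg.trans_le (min_le_right _ _))
    have hSg : S (T g x) = T g (S x) := congrFun (hScomm g) x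
    have hS'g : S' (T g x) = T g (S' x) := congrFun (hS'comm g) x
    rw [hSg] at h₁
    rw [hS'g, hd_symm] at h₂
    linarith [hd_tri (S y) (T g (S x)) (S' y), hd_tri (T g (S x)) (T g (S' x)) (S' y),
      hlip g (S x) (S' x)]
  have : Nonempty X := ⟨x⟩
  exact le_antisymm (ciSup_le key)
    (le_ciSup (f := fun y => d (S y) (S' y)) ⟨_, Set.forall_mem_range.2 key⟩ x)
end

section
/- Let d be a complete metric on X with respect to which the action T is 1-Lipschitz, and let x ∈ X be a transitive point. Then the evaluation map ev_x : Λ → X, ev_x(S) = S x, is a bijection: for every y ∈ X there exists exactly one d-continuous map S : X → X with S ∘ T_g = T_g ∘ S for all g ∈ G and S x = y. -/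
/-- Along a commuting 1-Lipschitz action, the orbit map of an arbitrary point is dominated by the
orbit map of a transitive point. -/
theorem dist_orbit_le_of_transitive
    {G : Type*} [AddCommMonoid G] {X : Type*} (T : G → X → X)
    (hTadd : ∀ g h : G, T (g + h) = T g ∘ T h)
    (d : X → X → ℝ)
    (hd_symm : ∀ x y : X, d x y = d y x)
    (hd_tri : ∀ x y z : X, d x z ≤ d x y + d y z)
    (hlip : ∀ (g : G) (x y : X), d (T g x) (T g y) ≤ d x y)
    (x : X) (hx : ∀ (y : X) (ε : ℝ), 0 < ε → ∃ g : G, d (T g x) y < ε)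
    (y : X) (g h : G) : d (T g y) (T h y) ≤ d (T g x) (T h x) := by
  have comm (a b : G) (z : X) : T a (T b z) = T b (T a z) := by
    rw [← Function.comp_apply (f := T a), ← hTadd, add_comm, hTadd, Function.comp_apply]
  refine le_of_forall_pos_le_add fun ε hε => ?_
  obtain ⟨k, hk⟩ := hx y (ε / 2) (half_pos hε)
  have h₁ := hlip g (T k x) y
  have h₂ := hlip h (T k x) y
  have h₃ := hlip k (T g x) (T h x)
  rw [comm k g, comm k h] at h₃
  have h₄ := hd_tri (T g y) (T g (T k x)) (T h y)
  have h₅ := hd_tri (T g (T k x)) (T h (T k x)) (T h y)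
  rw [hd_symm (T g y) (T g (T k x))] at h₄
  linarith

/-- In a complete space, every point `z` has a partner `p` that is at least as close to each point
of the orbit of `y` as `z` is to the corresponding point of the transitive orbit. -/
theorem exists_forall_dist_orbit_le
    {G : Type*} [AddCommMonoid G] {X : Type*} (T : G → X → X)
    (hTadd : ∀ g h : G, T (g + h) = T g ∘ T h)
    (d : X → X → ℝ)
    (hd_symm : ∀ x y : X, d x y = d y x)
    (hd_tri : ∀ x y z : X, d x z ≤ d x y + d y z)
    (hd_complete : ∀ u : ℕ → X,
      (∀ ε : ℝ, 0 < ε → ∃ N : ℕ, ∀ m ≥ N, ∀ n ≥ N, d (u m) (u n) < ε) →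
      ∃ z : X, ∀ ε : ℝ, 0 < ε → ∃ N : ℕ, ∀ n ≥ N, d (u n) z < ε)
    (hlip : ∀ (g : G) (x y : X), d (T g x) (T g y) ≤ d x y)
    (x : X) (hx : ∀ (y : X) (ε : ℝ), 0 < ε → ∃ g : G, d (T g x) y < ε)
    (y z : X) : ∃ p : X, ∀ g : G, d (T g y) p ≤ d (T g x) z := by
  have dom := dist_orbit_le_of_transitive T hTadd d hd_symm hd_tri hlip x hx y
  choose k hk using fun n : ℕ => hx z (1 / ((n : ℝ) + 1)) Nat.one_div_pos_of_nat
  have conv (ε : ℝ) (hε : 0 < ε) : ∃ N : ℕ, ∀ n ≥ N, d (T (k n) x) z < ε := by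
    obtain ⟨N, hN⟩ := exists_nat_one_div_lt hε
    exact ⟨N, fun n hn => (hk n).trans ((Nat.one_div_le_one_div hn).trans_lt hN)⟩
  obtain ⟨p, hp⟩ := hd_complete (fun n => T (k n) y) fun ε hε => by
    obtain ⟨N, hN⟩ := conv (ε / 2) (half_pos hε)
    refine ⟨N, fun m hm n hn => ?_⟩
    have h₁ := hd_tri (T (k m) x) z (T (k n) x)
    rw [hd_symm z] at h₁
    linarith [dom (k m) (k n), hN m hm, hN n hn]
  refine ⟨p, fun g => le_of_forall_pos_le_add fun ε hε => ?_⟩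
  obtain ⟨M, hM⟩ := hp (ε / 2) (half_pos hε)
  obtain ⟨N, hN⟩ := conv (ε / 2) (half_pos hε)
  have h₁ := hM (max M N) (le_max_left _ _)
  have h₂ := hN (max M N) (le_max_right _ _)
  have h₃ := hd_tri (T g y) (T (k (max M N)) y) p
  have h₄ := hd_tri (T g x) z (T (k (max M N)) x)
  rw [hd_symm z] at h₄
  linarith [dom g (k (max M N))]


/-- Let `d` be a complete metric (bounded by 1) on `X` with respect to
which the action `T` is 1-Lipschitz, and let `x ∈ X` be a transitive point. Then the
evaluation map `ev_x : Λ → X` is a bijection: for every `y ∈ X` there exists exactly one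
`d`-continuous map `S : X → X` commuting with every `T g` such that `S x = y`. -/
theorem evaluation_bijective
    {G : Type*} [AddCommMonoid G] [Countable G]
    (hcancel : ∀ g h k : G, g + h = g + k → h = k)
    (hnoinv : ∀ g h : G, g + h = 0 → g = 0 ∧ h = 0)
    {X : Type*}
    (T : G → X → X)
    (hT0 : T 0 = id)
    (hTadd : ∀ g h : G, T (g + h) = T g ∘ T h)
    -- `d` is a metric on `X`, bounded by 1
    (d : X → X → ℝ)
    (hd_eq : ∀ x y : X, d x y = 0 ↔ x = y)
    (hd_symm : ∀ x y : X, d x y = d y x)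
    (hd_tri : ∀ x y z : X, d x z ≤ d x y + d y z)
    (hd_nonneg : ∀ x y : X, 0 ≤ d x y)
    (hd_bdd : ∀ x y : X, d x y ≤ 1)
    -- `d` is complete: every `d`-Cauchy sequence `d`-converges
    (hd_complete : ∀ u : ℕ → X,
      (∀ ε : ℝ, 0 < ε → ∃ N : ℕ, ∀ m ≥ N, ∀ n ≥ N, d (u m) (u n) < ε) →
      ∃ z : X, ∀ ε : ℝ, 0 < ε → ∃ N : ℕ, ∀ n ≥ N, d (u n) z < ε)
    -- `T` is 1-Lipschitz with respect to `d`
    (hlip : ∀ (g : G) (x y : X), d (T g x) (T g y) ≤ d x y)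
    -- `x` is a transitive point: the orbit of `x` is `d`-dense
    (x : X)
    (hx : ∀ (y : X) (ε : ℝ), 0 < ε → ∃ g : G, d (T g x) y < ε) :
    ∀ y : X, ∃! S : X → X,
      (∀ (z : X) (ε : ℝ), 0 < ε → ∃ δ : ℝ, 0 < δ ∧
        ∀ w : X, d z w < δ → d (S z) (S w) < ε) ∧
      (∀ g : G, S ∘ T g = T g ∘ S) ∧ S x = y := by
  intro y
  have eq_of_small (a b : X) (h : ∀ ε : ℝ, 0 < ε → d a b ≤ ε) : a = b :=
    (hd_eq a b).1 (le_antisymm (le_of_forall_pos_le_add fun ε hε => by simpa using h ε hε)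
      (hd_nonneg a b))
  choose S hS using
    exists_forall_dist_orbit_le T hTadd d hd_symm hd_tri hd_complete hlip x hx y
  refine ⟨S, ⟨fun z ε hε => ⟨ε / 2, half_pos hε, fun w hw => ?_⟩, fun g => ?_, ?_⟩, ?_⟩
  · obtain ⟨g, hg⟩ := hx z (ε / 4) (by linarith)
    have h₁ := hd_tri (S z) (T g y) (S w)
    rw [hd_symm (S z) (T g y)] at h₁
    linarith [hS z g, hS w g, hd_tri (T g x) z w]
  · funext z
    refine eq_of_small _ _ fun ε hε => ?_
    obtain ⟨h, hh⟩ := hx z (ε / 2) (half_pos hε)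
    have h₁ := hS (T g z) (g + h)
    rw [hTadd, Function.comp_apply, Function.comp_apply] at h₁
    have h₂ := hd_tri (S (T g z)) (T g (T h y)) (T g (S z))
    rw [hd_symm (S (T g z)) (T g (T h y))] at h₂
    simp only [Function.comp_apply]
    linarith [hlip g (T h x) z, hlip g (T h y) (S z), hS z h]
  · refine (eq_of_small _ _ fun ε hε => ?_).symm
    have h₁ := hS x 0
    rw [hT0, id, id, (hd_eq x x).2 rfl] at h₁
    exact h₁.trans hε.le
  · rintro R ⟨hRcont, hRcomm, hRx⟩
    funext z
    refine eq_of_small _ _ fun ε hε => ?_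
    obtain ⟨δ, hδ, hR⟩ := hRcont z (ε / 2) (half_pos hε)
    obtain ⟨g, hg⟩ := hx z (min δ (ε / 2)) (lt_min hδ (half_pos hε))
    have h₁ := hR (T g x) (by rw [hd_symm]; exact hg.trans_le (min_le_left _ _))
    have h₂ : R (T g x) = T g y := by rw [← hRx]; exact congrFun (hRcomm g) x
    rw [h₂] at h₁
    linarith [hd_tri (R z) (T g y) (S z), hS z g, hg.trans_le (min_le_right δ (ε / 2))]
end

section
/- Let d be a complete metric on X with respect to which the action T is 1-Lipschitz, and suppose there exists a G-transitive point x ∈ X. Then Λ = {S ∈ C_d(X) : S T_g = T_g S for all g ∈ G} is a group under composition: every S ∈ Λ has an inverse S' ∈ Λ with S' ∘ S = S ∘ S' = id. In particular, each map T_g (g ∈ G) is a bijection of X. -/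
/-- Two continuous maps commuting with a family of 1-Lipschitz maps are nowhere further apart than
at a point whose orbit under the family is dense. -/
lemma dist_le_dist_of_commute_of_denseRange {X ι : Type*} [PseudoMetricSpace X] {T : ι → X → X}
    (hlip : ∀ i y z, dist (T i y) (T i z) ≤ dist y z) {x : X} (hx : DenseRange fun i => T i x)
    {f g : X → X} (hf : Continuous f) (hg : Continuous g)
    (hfT : ∀ i, f ∘ T i = T i ∘ f) (hgT : ∀ i, g ∘ T i = T i ∘ g) (w : X) :
    dist (f w) (g w) ≤ dist (f x) (g x) := by
  refine hx.induction_on (p := fun w => dist (f w) (g w) ≤ dist (f x) (g x)) w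
    (isClosed_le (hf.dist hg) continuous_const) fun i => ?_
  have h₁ : f (T i x) = T i (f x) := congrFun (hfT i) x
  have h₂ : g (T i x) = T i (g x) := congrFun (hgT i) x
  rw [h₁, h₂]
  exact hlip i _ _

/-- A 1-Lipschitz self-map with a left approximate inverse by 1-Lipschitz maps is an isometry. -/
lemma isometry_of_forall_exists_dist_comp_le {X : Type*} [PseudoMetricSpace X] {f : X → X}
    (hf : ∀ y z, dist (f y) (f z) ≤ dist y z)
    (h : ∀ ε > 0, ∃ k : X → X, (∀ y z, dist (k y) (k z) ≤ dist y z) ∧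
      ∀ w, dist (k (f w)) w ≤ ε) : Isometry f := by
  refine Isometry.of_dist_eq fun y z => le_antisymm (hf y z) ?_
  refine le_of_forall_pos_le_add fun ε hε => ?_
  obtain ⟨k, hk, hkf⟩ := h (ε / 2) (half_pos hε)
  have h₁ := dist_triangle4 y (k (f y)) (k (f z)) z
  have h₂ := hkf y
  rw [dist_comm] at h₂
  linarith [hkf z, hk (f y) (f z)]

/-- A uniform limit of isometries is an isometry. -/
lemma isometry_of_forall_exists_isometry_dist_le {X Y : Type*} [PseudoMetricSpace X]
    [PseudoMetricSpace Y] {f : X → Y}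
    (h : ∀ ε > 0, ∃ k : X → Y, Isometry k ∧ ∀ w, dist (k w) (f w) ≤ ε) : Isometry f := by
  refine Isometry.of_dist_eq fun y z => eq_of_forall_dist_le fun ε hε => ?_
  obtain ⟨k, hk, hkf⟩ := h (ε / 2) (half_pos hε)
  rw [← hk.dist_eq y z, dist_comm (dist (f y) (f z))]
  linarith [dist_dist_dist_le (k y) (k z) (f y) (f z), hkf y, hkf z]

/-- An isometry out of a complete space whose values come arbitrarily close to every point is
bijective. -/
lemma Isometry.bijective_of_forall_exists_dist_le {X Y : Type*} [MetricSpace X] [CompleteSpace X]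
    [MetricSpace Y] {f : X → Y} (hf : Isometry f)
    (h : ∀ z, ∀ ε > 0, ∃ w, dist z (f w) ≤ ε) : Function.Bijective f := by
  refine ⟨hf.injective, fun z => ?_⟩
  have hz : z ∈ closure (Set.range f) := Metric.mem_closure_range_iff.2 fun ε hε => by
    obtain ⟨w, hw⟩ := h z (ε / 2) (half_pos hε)
    exact ⟨w, hw.trans_lt (half_lt_self hε)⟩
  rwa [hf.isClosedEmbedding.isClosed_range.closure_eq] at hz


/-- Let `d` be a complete metric (bounded by 1) on `X` with respect to
which the action `T` is 1-Lipschitz, and suppose there exists a `G`-transitive point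
`x ∈ X`. Then the commutant `Λ` of the action (the `d`-continuous maps commuting with
every `T g`) is a group under composition: every `S ∈ Λ` has an inverse `S' ∈ Λ`.
In particular, each map `T g` is a bijection of `X`. -/
theorem commutant_is_group
    {G : Type*} [AddCommMonoid G] [Countable G]
    (hcancel : ∀ g h k : G, g + h = g + k → h = k)
    (hnoinv : ∀ g h : G, g + h = 0 → g = 0 ∧ h = 0)
    {X : Type*}
    (T : G → X → X)
    (hT0 : T 0 = id)
    (hTadd : ∀ g h : G, T (g + h) = T g ∘ T h)
    -- `d` is a metric on `X`, bounded by 1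
    (d : X → X → ℝ)
    (hd_eq : ∀ x y : X, d x y = 0 ↔ x = y)
    (hd_symm : ∀ x y : X, d x y = d y x)
    (hd_tri : ∀ x y z : X, d x z ≤ d x y + d y z)
    (hd_nonneg : ∀ x y : X, 0 ≤ d x y)
    (hd_bdd : ∀ x y : X, d x y ≤ 1)
    -- `d` is complete: every `d`-Cauchy sequence `d`-converges
    (hd_complete : ∀ u : ℕ → X,
      (∀ ε : ℝ, 0 < ε → ∃ N : ℕ, ∀ m ≥ N, ∀ n ≥ N, d (u m) (u n) < ε) →
      ∃ z : X, ∀ ε : ℝ, 0 < ε → ∃ N : ℕ, ∀ n ≥ N, d (u n) z < ε)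
    -- `T` is 1-Lipschitz with respect to `d`
    (hlip : ∀ (g : G) (x y : X), d (T g x) (T g y) ≤ d x y)
    -- `x` is a `G`-transitive point
    (x : X)
    (hx : ∀ (g : G) (y : X) (ε : ℝ), 0 < ε →
      ∃ h : G, (∃ k : G, h = g + k) ∧ d (T h x) y < ε) :
    (∀ S : X → X,
      (∀ (z : X) (ε : ℝ), 0 < ε → ∃ δ : ℝ, 0 < δ ∧
        ∀ w : X, d z w < δ → d (S z) (S w) < ε) →
      (∀ g : G, S ∘ T g = T g ∘ S) →
      ∃ S' : X → X,
        (∀ (z : X) (ε : ℝ), 0 < ε → ∃ δ : ℝ, 0 < δ ∧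
          ∀ w : X, d z w < δ → d (S' z) (S' w) < ε) ∧
        (∀ g : G, S' ∘ T g = T g ∘ S') ∧
        S' ∘ S = id ∧ S ∘ S' = id) ∧
    ∀ g : G, Function.Bijective (T g) := by
  let _ : MetricSpace X :=
    { dist := d
      dist_self := fun y => (hd_eq y y).2 rfl
      dist_comm := hd_symm
      dist_triangle := hd_tri
      eq_of_dist_eq_zero := fun {y z} => (hd_eq y z).1 }
  have hcomplete : CompleteSpace X := Metric.complete_of_cauchySeq_tendsto fun u hu => by
    obtain ⟨z, hz⟩ := hd_complete u (Metric.cauchySeq_iff.1 hu)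
    exact ⟨z, Metric.tendsto_atTop.2 hz⟩
  have hcont : ∀ S : X → X, (∀ (z : X) (ε : ℝ), 0 < ε → ∃ δ : ℝ, 0 < δ ∧
      ∀ w : X, d z w < δ → d (S z) (S w) < ε) ↔ Continuous S := by
    intro S
    rw [Metric.continuous_iff']
    simp only [Metric.eventually_nhds_iff]
    refine forall_congr' fun z => forall_congr' fun ε => forall_congr' fun _ =>
      exists_congr fun δ => and_congr_right fun _ => forall_congr' fun w => ?_
    rw [hd_symm z w, hd_symm (S z) (S w)]
    rfl
  have hTcont : ∀ g, Continuous (T g) := fun g =>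
    (LipschitzWith.mk_one (hlip g)).continuous
  have hTcomm : ∀ g h, T g ∘ T h = T h ∘ T g := fun g h => by
    rw [← hTadd, add_comm, hTadd]
  have hdense : DenseRange fun g => T g x := fun y =>
    Metric.mem_closure_range_iff.2 fun ε hε => by
      obtain ⟨h, -, hh⟩ := hx 0 y ε hε
      exact ⟨h, (hd_symm _ _).trans_lt hh⟩
  have hnear : ∀ S : X → X, Continuous S → (∀ g, S ∘ T g = T g ∘ S) → ∀ g, ∀ ε > 0,
      ∃ k, ∀ w, dist (T (g + k) w) (S w) ≤ ε := by
    intro S hS hST g ε hε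
    obtain ⟨_, ⟨k, rfl⟩, hk⟩ := hx g (S x) ε hε
    exact ⟨k, fun w => (dist_le_dist_of_commute_of_denseRange hlip hdense (hTcont _) hS
      (hTcomm _) hST w).trans hk.le⟩
  have hTnear : ∀ g, ∀ ε > 0, ∃ k, ∀ w, dist (T (g + k) w) w ≤ ε := fun g =>
    hnear id continuous_id (fun _ => rfl) g
  have hTiso : ∀ g, Isometry (T g) := fun g =>
    isometry_of_forall_exists_dist_comp_le (hlip g) fun ε hε => by
      obtain ⟨k, hk⟩ := hTnear g ε hε
      refine ⟨T k, hlip k, fun w => ?_⟩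
      simpa [add_comm g k, hTadd] using hk w
  have hTbij : ∀ g, Function.Bijective (T g) := fun g =>
    (hTiso g).bijective_of_forall_exists_dist_le fun z ε hε => by
      obtain ⟨k, hk⟩ := hTnear g ε hε
      refine ⟨T k z, ?_⟩
      simpa [dist_comm, hTadd] using hk z
  refine ⟨fun S hS hST => ?_, hTbij⟩
  have hSnear := hnear S ((hcont S).1 hS) hST 0
  have hSiso : Isometry S := isometry_of_forall_exists_isometry_dist_le fun ε hε =>
    let ⟨k, hk⟩ := hSnear ε hε
    ⟨T (0 + k), hTiso _, hk⟩
  have hSbij : Function.Bijective S := hSiso.bijective_of_forall_exists_dist_le fun z ε hε => by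
    obtain ⟨k, hk⟩ := hSnear ε hε
    obtain ⟨w, rfl⟩ := (hTbij (0 + k)).surjective z
    exact ⟨w, hk w⟩
  obtain ⟨S', hleft, hright⟩ := Function.bijective_iff_has_inverse.1 hSbij
  refine ⟨S', (hcont S').2 (hSiso.right_inv hright).continuous, fun g => ?_,
    hleft.comp_eq_id, hright.comp_eq_id⟩
  funext y
  refine hSbij.injective ?_
  have h := congrFun (hST g) (S' y)
  simp only [Function.comp_apply] at h ⊢
  rw [h, hright, hright]
end

section
/- Let H ⊆ G be a sub-semigroup that is syndetic in G, witnessed by the finite set F ⊆ G, and let d be a metric on X such that d(T_h x, T_h y) = d(x, y) for all x, y ∈ X and all h ∈ H. Then for all x, y ∈ X and every g ∈ G there exists f ∈ F such that d(T_g x, T_g y) = d(T_f x, T_f y). -/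
/-- Let `H ⊆ G` be a sub-semigroup that is syndetic in `G`, witnessed
by the finite set `F ⊆ G`, and let `d` be a metric on `X` such that `T h` is a
`d`-isometry for every `h ∈ H`. Then for all `x, y ∈ X` and every `g ∈ G` there exists
`f ∈ F` such that `d (T g x) (T g y) = d (T f x) (T f y)`. -/
theorem syndetic_isometry_transfer
    {G : Type*} [AddCommMonoid G] [Countable G]
    (hcancel : ∀ g h k : G, g + h = g + k → h = k)
    (hnoinv : ∀ g h : G, g + h = 0 → g = 0 ∧ h = 0)
    {X : Type*}
    (T : G → X → X)
    (hT0 : T 0 = id)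
    (hTadd : ∀ g h : G, T (g + h) = T g ∘ T h)
    -- `H` is a sub-semigroup of `G`
    (H : Set G) (hHne : H.Nonempty)
    (hHadd : ∀ a ∈ H, ∀ b ∈ H, a + b ∈ H)
    -- `H` is syndetic in `G`, witnessed by the finite set `F`
    (F : Finset G)
    (hsyn : ∀ g : G, ∃ f ∈ F, f + g ∈ H)
    -- `d` is a metric on `X`
    (d : X → X → ℝ)
    (hd_eq : ∀ x y : X, d x y = 0 ↔ x = y)
    (hd_symm : ∀ x y : X, d x y = d y x)
    (hd_tri : ∀ x y z : X, d x z ≤ d x y + d y z)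
    (hd_nonneg : ∀ x y : X, 0 ≤ d x y)
    -- the action of `H` is isometric with respect to `d`
    (hiso : ∀ h ∈ H, ∀ x y : X, d (T h x) (T h y) = d x y) :
    ∀ (x y : X) (g : G), ∃ f ∈ F, d (T g x) (T g y) = d (T f x) (T f y) := by
  intro x y g
  obtain ⟨k, -, hkg⟩ := hsyn g
  obtain ⟨f, hf, hfk⟩ := hsyn k
  refine ⟨f, hf, ?_⟩
  have hT : ∀ a b z, T a (T b z) = T (a + b) z := fun a b z => by
    rw [hTadd, Function.comp_apply]
  rw [← hiso _ hfk (T g x), ← hiso _ hkg (T f x)]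
  simp only [hT]
  rw [show f + k + g = k + g + f by abel]
end

section
/- Let H ⊆ G be a sub-semigroup that is thick in G, and let d be a metric on X such that d(T_h x, T_h y) = d(x, y) for all x, y ∈ X and all h ∈ H. Then the whole action is isometric: d(T_g x, T_g y) = d(x, y) for all x, y ∈ X and every g ∈ G. -/
/-- Let `H ⊆ G` be a sub-semigroup that is thick in `G`, and let `d`
be a metric on `X` such that `T h` is a `d`-isometry for every `h ∈ H`. Then the whole
action is isometric: `d (T g x) (T g y) = d x y` for all `x, y ∈ X` and every `g ∈ G`. -/
theorem thick_isometry_extends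
    {G : Type*} [AddCommMonoid G] [Countable G]
    (hcancel : ∀ g h k : G, g + h = g + k → h = k)
    (hnoinv : ∀ g h : G, g + h = 0 → g = 0 ∧ h = 0)
    {X : Type*}
    (T : G → X → X)
    (hT0 : T 0 = id)
    (hTadd : ∀ g h : G, T (g + h) = T g ∘ T h)
    -- `H` is a sub-semigroup of `G`
    (H : Set G) (hHne : H.Nonempty)
    (hHadd : ∀ a ∈ H, ∀ b ∈ H, a + b ∈ H)
    -- `H` is thick in `G`
    (hthick : ∀ F : Finset G, ∃ p : G, ∀ f ∈ F, f + p ∈ H)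
    -- `d` is a metric on `X`
    (d : X → X → ℝ)
    (hd_eq : ∀ x y : X, d x y = 0 ↔ x = y)
    (hd_symm : ∀ x y : X, d x y = d y x)
    (hd_tri : ∀ x y z : X, d x z ≤ d x y + d y z)
    (hd_nonneg : ∀ x y : X, 0 ≤ d x y)
    -- the action of `H` is isometric with respect to `d`
    (hiso : ∀ h ∈ H, ∀ x y : X, d (T h x) (T h y) = d x y) :
    ∀ (g : G) (x y : X), d (T g x) (T g y) = d x y := by
  intro g x y
  classical
  obtain ⟨p, hp⟩ := hthick {0, g}
  have hpH : p ∈ H := by simpa using hp 0 (by simp)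
  have hpgH : p + g ∈ H := by simpa [add_comm] using hp g (by simp)
  have h := hiso _ hpgH x y
  rw [hTadd] at h
  exact (hiso p hpH (T g x) (T g y)).symm.trans h
end
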